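/- Let k be a field with char k ≠ 2, let d ≥ 2 be an integer, and let I ⊆ R = k[x,y,z] be a proper homogeneous 𝔪-primary ideal generated by its degree-d homogeneous component, with dim_k I_d = 2d+1 and dim_k Soc(R/I) = 1 (a codimension-3 Gorenstein ideal with datum (d, 2d+1)). Then I^N = 𝔪^{dN} for every integer N ≥ 2. -/

import Mathlib

open MvPolynomial

/-- The maximal graded ideal `𝔪 = (x, y, z)` of `k[x,y,z]`. -/
noncomputable def mIdeal (k : Type*) [Field k] : Ideal (MvPolynomial (Fin 3) k) :=
  Ideal.span (Set.range (X : Fin 3 → MvPolynomial (Fin 3) k))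

/-- `dim_k Soc(R/I)`, the total dimension of the socle `(I : 𝔪)/I` of `R/I`. -/
noncomputable def socDim {k : Type*} [Field k] (I : Ideal (MvPolynomial (Fin 3) k)) : ℕ :=
  Module.finrank k
    ↥(Submodule.map (Ideal.Quotient.mkₐ k I).toLinearMap
      ((Submodule.colon I (mIdeal k)).restrictScalars k))

namespace MvPolynomial

/-- A `k`-subspace containing all monomials of degree `n` contains all forms of degree `n`. -/
theorem homogeneousSubmodule_le_of_monomial_mem {σ k : Type*} [Field k] {n : ℕ}
    {W : Submodule k (MvPolynomial σ k)}
    (h : ∀ s : σ →₀ ℕ, s.degree = n → monomial s 1 ∈ W) :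
    homogeneousSubmodule σ k n ≤ W := by
  intro p hp
  rw [p.as_sum]
  refine Submodule.sum_mem _ fun s hs => ?_
  have hd : s.degree = n := by
    by_contra hne
    exact (mem_support_iff.1 hs) (IsHomogeneous.coeff_eq_zero hp hne)
  have := W.smul_mem (coeff s p) (h s hd)
  rwa [smul_monomial, smul_eq_mul, mul_one] at this

theorem IsHomogeneous.divMonomial_single {σ k : Type*} [Field k] {n : ℕ} {i : σ}
    {p : MvPolynomial σ k} (hp : p.IsHomogeneous (n + 1)) :
    (p.divMonomial (Finsupp.single i 1)).IsHomogeneous n := by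
  intro s hs
  rw [coeff_divMonomial] at hs
  have := hp hs
  simp only [map_add, Finsupp.weight_single, Pi.one_apply, smul_eq_mul, mul_one] at this
  omega

theorem IsHomogeneous.divMonomial_single_eq_zero {σ k : Type*} [Field k] {i : σ}
    {p : MvPolynomial σ k} (hp : p.IsHomogeneous 0) :
    p.divMonomial (Finsupp.single i 1) = 0 := by
  ext s
  rw [coeff_divMonomial, coeff_zero]
  apply hp.coeff_eq_zero
  simp

theorem IsHomogeneous.X_mul_divMonomial_single {σ k : Type*} [Field k] {n : ℕ} {i : σ} (j : σ)
    {p : MvPolynomial σ k} (hp : p.IsHomogeneous n) :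
    (X j * (p.divMonomial (Finsupp.single i 1))).IsHomogeneous n := by
  cases n with
  | zero =>
    rw [IsHomogeneous.divMonomial_single_eq_zero hp, mul_zero]
    exact isHomogeneous_zero _ _ _
  | succ n =>
    rw [add_comm n 1]
    exact (isHomogeneous_X k j).mul (IsHomogeneous.divMonomial_single hp)

theorem X_mul_divMonomial_single_of_ne {σ k : Type*} [Field k] {i j : σ} (hij : i ≠ j)
    (p : MvPolynomial σ k) :
    divMonomial (X j * p) (Finsupp.single i 1) = X j * (p.divMonomial (Finsupp.single i 1)) := by
  classical
  ext s
  rw [coeff_divMonomial, coeff_X_mul', coeff_X_mul', coeff_divMonomial]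
  have h1 : (j ∈ (Finsupp.single i 1 + s).support) ↔ j ∈ s.support := by
    simp [hij]
  simp only [h1]
  split_ifs with h
  · congr 1
    rw [add_tsub_assoc_of_le]
    rw [Finsupp.single_le_iff]
    rw [Finsupp.mem_support_iff] at h
    omega
  · rfl

theorem X_pow_mul_divMonomial_single_of_ne {σ k : Type*} [Field k] {i j : σ} (hij : i ≠ j)
    (r : ℕ) (p : MvPolynomial σ k) :
    divMonomial (X j ^ r * p) (Finsupp.single i 1) =
      X j ^ r * (p.divMonomial (Finsupp.single i 1)) := by
  induction r with
  | zero => simp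
  | succ r ih =>
    rw [pow_succ', mul_assoc, X_mul_divMonomial_single_of_ne hij, ih, mul_assoc]

theorem IsHomogeneous.of_X_mul {σ k : Type*} [Field k] {n : ℕ} {i : σ}
    {p : MvPolynomial σ k} (hp : (X i * p).IsHomogeneous (n + 1)) : p.IsHomogeneous n := by
  have := IsHomogeneous.divMonomial_single (i := i) hp
  rwa [X_mul_divMonomial] at this

/-- Division by a variable as a linear map. -/
noncomputable def divX {σ : Type*} (k : Type*) [Field k] (i : σ) :
    MvPolynomial σ k →ₗ[k] MvPolynomial σ k where
  toFun p := p.divMonomial (Finsupp.single i 1)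
  map_add' p q := add_divMonomial p q _
  map_smul' c p := by
    ext s
    simp

/-- The dehomogenization `k[x,y,z] → k[t]` with `x ↦ t`, `y ↦ 1`, `z ↦ 0`. -/
noncomputable def dehomog (k : Type*) [Field k] : MvPolynomial (Fin 3) k →ₐ[k] Polynomial k :=
  aeval ![Polynomial.X, 1, 0]

@[simp] theorem dehomog_X0 (k : Type*) [Field k] : dehomog k (X 0) = Polynomial.X := by
  simp [dehomog]

@[simp] theorem dehomog_X1 (k : Type*) [Field k] : dehomog k (X 1) = 1 := by
  simp [dehomog]

@[simp] theorem dehomog_X2 (k : Type*) [Field k] : dehomog k (X 2) = 0 := by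
  simp [dehomog]

theorem monomial_fin_three {k : Type*} [Field k] (s : Fin 3 →₀ ℕ) :
    (monomial s 1 : MvPolynomial (Fin 3) k) = X 0 ^ s 0 * X 1 ^ s 1 * X 2 ^ s 2 := by
  rw [monomial_eq, Finsupp.prod_fintype _ _ (by simp)]
  simp [Fin.prod_univ_three]

theorem degree_fin_three (s : Fin 3 →₀ ℕ) : s.degree = s 0 + s 1 + s 2 := by
  rw [Finsupp.degree_eq_sum, Fin.sum_univ_three]

/-- A subspace containing all `z`-multiples and all monomials `x^a y^b` with `a + b = n` contains
all forms of degree `n`. -/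
theorem homogeneousSubmodule_le_of_mem {k : Type*} [Field k] {n : ℕ}
    {W : Submodule k (MvPolynomial (Fin 3) k)} (hz : ∀ p, X 2 * p ∈ W)
    (hxy : ∀ a b, a + b = n → X 0 ^ a * X 1 ^ b ∈ W) :
    homogeneousSubmodule (Fin 3) k n ≤ W := by
  refine homogeneousSubmodule_le_of_monomial_mem fun s hs => ?_
  rw [degree_fin_three] at hs
  rw [monomial_fin_three]
  rcases hc : s 2 with _ | c
  · rw [pow_zero, mul_one]
    exact hxy _ _ (by omega)
  · convert hz (X 0 ^ s 0 * X 1 ^ s 1 * X 2 ^ c) using 1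
    ring

theorem dehomog_mem_degreeLT {k : Type*} [Field k] {n : ℕ} {p : MvPolynomial (Fin 3) k}
    (hp : p.IsHomogeneous n) : dehomog k p ∈ Polynomial.degreeLT k (n + 1) := by
  have : homogeneousSubmodule (Fin 3) k n ≤
      (Polynomial.degreeLT k (n + 1)).comap (dehomog k).toLinearMap := by
    refine homogeneousSubmodule_le_of_mem (fun p => ?_) (fun a b h => ?_)
    · simp
    · simp only [Submodule.mem_comap, AlgHom.toLinearMap_apply, map_mul, map_pow, dehomog_X0,
        dehomog_X1, one_pow, mul_one, Polynomial.mem_degreeLT, Polynomial.degree_X_pow]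
      exact_mod_cast (by omega : a < n + 1)
  exact this hp

theorem map_dehomog_homogeneousSubmodule (k : Type*) [Field k] (n : ℕ) :
    (homogeneousSubmodule (Fin 3) k n).map (dehomog k).toLinearMap =
      Polynomial.degreeLT k (n + 1) := by
  classical
  refine le_antisymm ?_ ?_
  · rintro _ ⟨p, hp, rfl⟩
    exact dehomog_mem_degreeLT hp
  · rw [Polynomial.degreeLT_eq_span_X_pow, Submodule.span_le]
    intro q hq
    simp only [Finset.coe_image, Finset.coe_range, Set.mem_image, Set.mem_Iio] at hq
    obtain ⟨a, ha, rfl⟩ := hq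
    refine ⟨X 0 ^ a * X 1 ^ (n - a), ?_, by simp⟩
    have := ((isHomogeneous_X k (0 : Fin 3)).pow a).mul
      ((isHomogeneous_X k (1 : Fin 3)).pow (n - a))
    rwa [show 1 * a + 1 * (n - a) = n by omega] at this

/-- The homogenization `t^a ↦ x^a y^(n-a)` in degree `n`. -/
noncomputable def rehomog (k : Type*) [Field k] (n : ℕ) :
    Polynomial k →ₗ[k] MvPolynomial (Fin 3) k :=
  (Polynomial.basisMonomials k).constr k fun a => X 0 ^ a * X 1 ^ (n - a)

theorem rehomog_X_pow (k : Type*) [Field k] (n a : ℕ) :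
    rehomog k n (Polynomial.X ^ a) = X 0 ^ a * X 1 ^ (n - a) := by
  have := (Polynomial.basisMonomials k).constr_basis k
    (fun a => (X 0 ^ a * X 1 ^ (n - a) : MvPolynomial (Fin 3) k)) a
  rwa [Polynomial.coe_basisMonomials, show (fun s => Polynomial.monomial s (1 : k)) a =
    Polynomial.X ^ a from Polynomial.monomial_one_right_eq_X_pow a] at this

theorem X2_dvd_sub_rehomog_dehomog {k : Type*} [Field k] {n : ℕ} {p : MvPolynomial (Fin 3) k}
    (hp : p.IsHomogeneous n) : X 2 ∣ p - rehomog k n (dehomog k p) := by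
  have key : homogeneousSubmodule (Fin 3) k n ≤
      ((Ideal.span {(X 2 : MvPolynomial (Fin 3) k)}).restrictScalars k).comap
        (LinearMap.id - rehomog k n ∘ₗ (dehomog k).toLinearMap) := by
    refine homogeneousSubmodule_le_of_mem (fun p => ?_) (fun a b h => ?_)
    · simp [Ideal.mem_span_singleton]
    · have hb : n - a = b := by omega
      simp [rehomog_X_pow, hb]
  have := key hp
  simpa [Ideal.mem_span_singleton] using this

theorem X2_dvd_of_dehomog_eq_zero {k : Type*} [Field k] {n : ℕ} {p : MvPolynomial (Fin 3) k}
    (hp : p.IsHomogeneous n) (h : dehomog k p = 0) : X 2 ∣ p := by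
  simpa [h] using X2_dvd_sub_rehomog_dehomog hp

section Syzygy

variable {k : Type*} [Field k] {e : ℕ} {V : Submodule k (MvPolynomial (Fin 3) k)}
  {φ : MvPolynomial (Fin 3) k →ₗ[k] k} {D : MvPolynomial (Fin 3) k →ₗ[k] MvPolynomial (Fin 3) k}

/-- If `D` respects linear syzygies, then the dehomogenization of `D` vanishes on the multiples of
`z` in `V`. -/
theorem dehomog_apply_X2_mul_eq_zero
    (hV : ∀ f, f ∈ V ↔ f.IsHomogeneous (e + 2) ∧ ∀ p, p.IsHomogeneous e → φ (f * p) = 0)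
    (hsurj : ∀ χ : MvPolynomial (Fin 3) k →ₗ[k] k, ∃ g, g.IsHomogeneous (e + 1) ∧
      ∀ p, p.IsHomogeneous (e + 1) → χ p = φ (g * p))
    (hinj : ∀ g, g.IsHomogeneous (e + 1) →
      (∀ p, p.IsHomogeneous (e + 1) → φ (g * p) = 0) → g = 0)
    (hD : ∀ a ∈ V, ∀ b ∈ V, ∀ c ∈ V, X 0 * a + X 1 * b + X 2 * c = 0 →
      X 0 * D a + X 1 * D b + X 2 * D c = 0)
    {g : MvPolynomial (Fin 3) k} (hg : g.IsHomogeneous (e + 1)) (hgV : X 2 * g ∈ V) :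
    dehomog k (D (X 2 * g)) = 0 := by
  suffices H : ∀ r : ℕ, ∀ g : MvPolynomial (Fin 3) k, g.IsHomogeneous (e + 1) → X 2 * g ∈ V →
      (∀ p, (X 0 ^ r * p).IsHomogeneous (e + 1) → φ (g * (X 0 ^ r * p)) = 0) →
      dehomog k (D (X 2 * g)) = 0 by
    refine H (e + 2) g hg hgV fun p hp => ?_
    have : X 0 ^ (e + 2) * p = 0 := by
      by_contra hne
      have h1 := hp.totalDegree hne
      rw [totalDegree_mul_of_isDomain (pow_ne_zero _ (X_ne_zero _)) (right_ne_zero_of_mul hne),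
        totalDegree_X_pow] at h1
      omega
    rw [this, mul_zero, map_zero]
  intro r
  induction r with
  | zero =>
    intro g hg _ h
    have : g = 0 := hinj g hg fun p hp => by simpa using h p (by simpa using hp)
    simp [this]
  | succ r ih =>
    intro g hg hgV h
    obtain ⟨g', hg', hφ⟩ := hsurj (φ ∘ₗ LinearMap.mulLeft k (g * X 0) ∘ₗ divX k 1)
    replace hφ : ∀ p, p.IsHomogeneous (e + 1) →
        φ (g' * p) = φ (g * (X 0 * p.divMonomial (Finsupp.single 1 1))) := by
      intro p hp
      rw [← hφ p hp, ← mul_assoc]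
      rfl
    have hgV' : X 2 * g' ∈ V := by
      refine (hV _).2 ⟨?_, fun p hp => ?_⟩
      · convert (isHomogeneous_X k 2).mul hg' using 1
        omega
      · have h2 : (X 2 * p).IsHomogeneous (e + 1) := by
          convert (isHomogeneous_X k 2).mul hp using 1
          omega
        have := ((hV _).1 hgV).2 _ (IsHomogeneous.X_mul_divMonomial_single (i := 1) 0 hp)
        rw [mul_comm (X 2) g', mul_assoc, hφ _ h2, X_mul_divMonomial_single_of_ne (by decide)]
        rw [← this]
        congr 1
        ring
    have hh : X 0 * g - X 1 * g' ∈ V := by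
      refine (hV _).2 ⟨?_, fun p hp => ?_⟩
      · rw [show e + 2 = 1 + (e + 1) by omega]
        exact ((isHomogeneous_X k 0).mul hg).sub ((isHomogeneous_X k 1).mul hg')
      · have h2 : (X 1 * p).IsHomogeneous (e + 1) := by
          convert (isHomogeneous_X k 1).mul hp using 1
          omega
        rw [sub_mul, map_sub, mul_comm (X 1) g', mul_assoc g', hφ _ h2, X_mul_divMonomial,
          mul_comm (X 0) g, mul_assoc, sub_self]
    have h0 : dehomog k (D (X 2 * g')) = 0 := by
      refine ih g' hg' hgV' fun p hp => ?_
      rw [hφ _ hp]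
      have h3 := IsHomogeneous.X_mul_divMonomial_single (i := 1) 0 hp
      rw [X_pow_mul_divMonomial_single_of_ne (by decide), ← mul_assoc (X 0), ← pow_succ'] at h3 ⊢
      exact h _ h3
    have key := hD (X 2 * g) hgV (-(X 2 * g')) (V.neg_mem hgV') (-(X 0 * g - X 1 * g'))
      (V.neg_mem hh) (by ring)
    have := congrArg (dehomog k) key
    simpa [h0] using this

/-- If `D` respects linear syzygies, then after dehomogenization it commutes with the passage from
`y q` to `x q` modulo `z`. -/
theorem dehomog_apply_eq_X_mul
    (hV : ∀ f, f ∈ V ↔ f.IsHomogeneous (e + 2) ∧ ∀ p, p.IsHomogeneous e → φ (f * p) = 0)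
    (hsurj : ∀ χ : MvPolynomial (Fin 3) k →ₗ[k] k, ∃ g, g.IsHomogeneous (e + 1) ∧
      ∀ p, p.IsHomogeneous (e + 1) → χ p = φ (g * p))
    (hinj : ∀ g, g.IsHomogeneous (e + 1) →
      (∀ p, p.IsHomogeneous (e + 1) → φ (g * p) = 0) → g = 0)
    (hD : ∀ a ∈ V, ∀ b ∈ V, ∀ c ∈ V, X 0 * a + X 1 * b + X 2 * c = 0 →
      X 0 * D a + X 1 * D b + X 2 * D c = 0)
    {q f f' : MvPolynomial (Fin 3) k} (hq : q.IsHomogeneous (e + 1)) (hf : f ∈ V) (hf' : f' ∈ V)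
    (h : X 2 ∣ X 0 * q - f) (h' : X 2 ∣ X 1 * q - f') :
    dehomog k (D f) = Polynomial.X * dehomog k (D f') := by
  obtain ⟨g₁, hg₁⟩ := h
  obtain ⟨g₂, hg₂⟩ := h'
  have hX : ∀ (i : Fin 3) {n : ℕ} {p : MvPolynomial (Fin 3) k}, p.IsHomogeneous n →
      (X i * p).IsHomogeneous (n + 1) := fun i n p hp => by
    rw [add_comm]
    exact (isHomogeneous_X k i).mul hp
  have hg₁' : g₁.IsHomogeneous (e + 1) := by
    refine IsHomogeneous.of_X_mul (i := 2) ?_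
    rw [← hg₁]
    exact (hX 0 hq).sub ((hV f).1 hf).1
  have hg₂' : g₂.IsHomogeneous (e + 1) := by
    refine IsHomogeneous.of_X_mul (i := 2) ?_
    rw [← hg₂]
    exact (hX 1 hq).sub ((hV f').1 hf').1
  set u := X 0 * g₂ - X 1 * g₁ with hu
  have hzu : X 2 * u = X 1 * f - X 0 * f' := by
    linear_combination X 1 * hg₁ - X 0 * hg₂
  obtain ⟨g, hg, hφ⟩ := hsurj (φ ∘ₗ LinearMap.mulLeft k u ∘ₗ divX k 0)
  replace hφ : ∀ p, p.IsHomogeneous (e + 1) →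
      φ (g * p) = φ (u * p.divMonomial (Finsupp.single 0 1)) := by
    intro p hp
    rw [← hφ p hp]
    rfl
  have hgV : X 2 * g ∈ V := by
    refine (hV _).2 ⟨hX 2 hg, fun p hp => ?_⟩
    rw [mul_comm (X 2) g, mul_assoc, hφ _ (hX 2 hp), X_mul_divMonomial_single_of_ne (by decide),
      ← mul_assoc, mul_comm u, hzu, sub_mul, map_sub]
    have h1 := ((hV f).1 hf).2 _ (IsHomogeneous.X_mul_divMonomial_single (i := 0) 1 hp)
    have h2 := ((hV f').1 hf').2 _ (IsHomogeneous.X_mul_divMonomial_single (i := 0) 0 hp)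
    rw [mul_comm (X 1) f, mul_assoc, h1, mul_comm (X 0) f', mul_assoc, h2, sub_zero]
  have hw : u - X 0 * g ∈ V := by
    refine (hV _).2 ⟨((hX 0 hg₂').sub (hX 1 hg₁')).sub (hX 0 hg), fun p hp => ?_⟩
    rw [sub_mul, map_sub, mul_comm (X 0) g, mul_assoc, hφ _ (hX 0 hp), X_mul_divMonomial, sub_self]
  have h0 := dehomog_apply_X2_mul_eq_zero hV hsurj hinj hD hg hgV
  have key := hD (-(f' + X 2 * g)) (V.neg_mem (V.add_mem hf' hgV)) f hf (-(u - X 0 * g))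
    (V.neg_mem hw) (by linear_combination -hzu)
  have := congrArg (dehomog k) key
  simp only [map_neg, map_add, map_mul, map_zero, h0, dehomog_X0, dehomog_X1, dehomog_X2] at this
  linear_combination this

/-- If `D` respects linear syzygies and takes values in forms of degree `m < e + 2`, then its
dehomogenization vanishes. -/
theorem dehomog_apply_eq_zero
    (hV : ∀ f, f ∈ V ↔ f.IsHomogeneous (e + 2) ∧ ∀ p, p.IsHomogeneous e → φ (f * p) = 0)
    (hsurj : ∀ χ : MvPolynomial (Fin 3) k →ₗ[k] k, ∃ g, g.IsHomogeneous (e + 1) ∧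
      ∀ p, p.IsHomogeneous (e + 1) → χ p = φ (g * p))
    (hinj : ∀ g, g.IsHomogeneous (e + 1) →
      (∀ p, p.IsHomogeneous (e + 1) → φ (g * p) = 0) → g = 0)
    (hlift : ∀ q : MvPolynomial (Fin 3) k, q.IsHomogeneous (e + 2) → ∃ f ∈ V, X 2 ∣ q - f)
    (hD : ∀ a ∈ V, ∀ b ∈ V, ∀ c ∈ V, X 0 * a + X 1 * b + X 2 * c = 0 →
      X 0 * D a + X 1 * D b + X 2 * D c = 0)
    {m : ℕ} (hm : m < e + 2) (hDm : ∀ f ∈ V, (D f).IsHomogeneous m)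
    {f : MvPolynomial (Fin 3) k} (hf : f ∈ V) : dehomog k (D f) = 0 := by
  have hxy : ∀ a b : ℕ, a + b = e + 2 →
      (X 0 ^ a * X 1 ^ b : MvPolynomial (Fin 3) k).IsHomogeneous (e + 2) := fun a b hab => by
    have := (isHomogeneous_X_pow (R := k) (0 : Fin 3) a).mul
      (isHomogeneous_X_pow (R := k) (1 : Fin 3) b)
    rwa [hab] at this
  choose! F hFV hF using hlift
  set G : ℕ → MvPolynomial (Fin 3) k := fun a => F (X 0 ^ a * X 1 ^ (e + 2 - a)) with hG
  have hstep : ∀ a, a < e + 2 →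
      dehomog k (D (G (a + 1))) = Polynomial.X * dehomog k (D (G a)) := by
    intro a ha
    have h1 := hxy (a + 1) (e + 2 - (a + 1)) (by omega)
    have h2 := hxy a (e + 2 - a) (by omega)
    have hq : (X 0 ^ a * X 1 ^ (e + 1 - a) : MvPolynomial (Fin 3) k).IsHomogeneous (e + 1) := by
      have := (isHomogeneous_X_pow (R := k) (0 : Fin 3) a).mul
        (isHomogeneous_X_pow (R := k) (1 : Fin 3) (e + 1 - a))
      rwa [show a + (e + 1 - a) = e + 1 by omega] at this
    refine dehomog_apply_eq_X_mul hV hsurj hinj hD hq (hFV _ h1) (hFV _ h2) ?_ ?_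
    · convert hF _ h1 using 2
      rw [show e + 2 - (a + 1) = e + 1 - a by omega]
      ring
    · convert hF _ h2 using 2
      rw [show e + 2 - a = e + 1 - a + 1 by omega]
      ring
  have hpow : ∀ a, a ≤ e + 2 →
      dehomog k (D (G a)) = Polynomial.X ^ a * dehomog k (D (G 0)) := by
    intro a
    induction a with
    | zero => simp
    | succ a ih =>
      intro ha
      rw [hstep a (by omega), ih (by omega), pow_succ']
      ring
  have hG0 : dehomog k (D (G 0)) = 0 := by
    by_contra hne
    have hdeg := dehomog_mem_degreeLT (hDm _ (hFV _ (hxy (e + 2) (e + 2 - (e + 2)) (by omega))))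
    change dehomog k (D (G (e + 2))) ∈ _ at hdeg
    rw [hpow _ le_rfl, Polynomial.mem_degreeLT, Polynomial.degree_mul, Polynomial.degree_X_pow,
      Polynomial.degree_eq_natDegree hne] at hdeg
    have : e + 2 + (dehomog k (D (G 0))).natDegree < m + 1 := by exact_mod_cast hdeg
    omega
  let N : Submodule k (MvPolynomial (Fin 3) k) :=
    V ⊓ LinearMap.ker ((dehomog k).toLinearMap ∘ₗ D)
  have hle : homogeneousSubmodule (Fin 3) k (e + 2) ≤
      N ⊔ (Ideal.span {(X 2 : MvPolynomial (Fin 3) k)}).restrictScalars k := by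
    refine homogeneousSubmodule_le_of_mem (fun p => ?_) fun a b hab => ?_
    · exact Submodule.mem_sup_right (by simp [Ideal.mem_span_singleton])
    · have hb : b = e + 2 - a := by omega
      subst hb
      have hmem := hxy a (e + 2 - a) hab
      refine Submodule.mem_sup.2 ⟨G a, ⟨hFV _ hmem, ?_⟩, _, ?_, add_sub_cancel _ _⟩
      · simp [hpow a (by omega), hG0]
      · simpa [Ideal.mem_span_singleton] using hF _ hmem
  obtain ⟨f₁, ⟨hf₁, hf₁'⟩, w, hw, hsum⟩ := Submodule.mem_sup.1 (hle ((hV f).1 hf).1)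
  rw [Submodule.restrictScalars_mem, Ideal.mem_span_singleton] at hw
  obtain ⟨g, rfl⟩ := hw
  have hgV : X 2 * g ∈ V := by
    rw [show X 2 * g = f - f₁ by rw [← hsum]; ring]
    exact V.sub_mem hf hf₁
  have h0 := dehomog_apply_X2_mul_eq_zero hV hsurj hinj hD
    (IsHomogeneous.of_X_mul ((hV _).1 hgV).1) hgV
  rw [← hsum, map_add, map_add, h0, add_zero]
  simpa using hf₁'

/-- A linear map of negative degree which respects linear syzygies is zero. -/
theorem apply_eq_zero_of_linear_syzygies
    (hV : ∀ f, f ∈ V ↔ f.IsHomogeneous (e + 2) ∧ ∀ p, p.IsHomogeneous e → φ (f * p) = 0)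
    (hsurj : ∀ χ : MvPolynomial (Fin 3) k →ₗ[k] k, ∃ g, g.IsHomogeneous (e + 1) ∧
      ∀ p, p.IsHomogeneous (e + 1) → χ p = φ (g * p))
    (hinj : ∀ g, g.IsHomogeneous (e + 1) →
      (∀ p, p.IsHomogeneous (e + 1) → φ (g * p) = 0) → g = 0)
    (hlift : ∀ q : MvPolynomial (Fin 3) k, q.IsHomogeneous (e + 2) → ∃ f ∈ V, X 2 ∣ q - f)
    {m : ℕ} (hm : m < e + 2) (hDm : ∀ f ∈ V, (D f).IsHomogeneous m)
    (hD : ∀ a ∈ V, ∀ b ∈ V, ∀ c ∈ V, X 0 * a + X 1 * b + X 2 * c = 0 →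
      X 0 * D a + X 1 * D b + X 2 * D c = 0)
    {f : MvPolynomial (Fin 3) k} (hf : f ∈ V) : D f = 0 := by
  induction m generalizing D f with
  | zero =>
    obtain ⟨c, hc⟩ := X2_dvd_of_dehomog_eq_zero (hDm f hf)
      (dehomog_apply_eq_zero hV hsurj hinj hlift hD hm hDm hf)
    have h1 := IsHomogeneous.divMonomial_single_eq_zero (i := 2) (hDm f hf)
    rw [hc, X_mul_divMonomial] at h1
    rw [hc, h1, mul_zero]
  | succ m ih =>
    have hdiv : ∀ f ∈ V, D f = X 2 * (divX k 2 ∘ₗ D) f := by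
      intro f hf
      obtain ⟨c, hc⟩ := X2_dvd_of_dehomog_eq_zero (hDm f hf)
        (dehomog_apply_eq_zero hV hsurj hinj hlift hD hm hDm hf)
      rw [LinearMap.comp_apply, hc]
      exact congrArg _ (X_mul_divMonomial _ _).symm
    have := ih (D := divX k 2 ∘ₗ D) (by omega)
      (fun f hf => IsHomogeneous.divMonomial_single (hDm f hf))
      (fun a ha b hb c hc h => by
        have h1 := hD a ha b hb c hc h
        rw [hdiv a ha, hdiv b hb, hdiv c hc] at h1
        refine mul_left_cancel₀ (X_ne_zero (R := k) (2 : Fin 3)) ?_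
        rw [mul_zero, ← h1]
        ring) hf
    rw [hdiv f hf, this, mul_zero]

end Syzygy

section Graded

variable {σ k : Type*} [Field k]

theorem homogeneousComponent_mul_of_isHomogeneous {d : ℕ} {w : MvPolynomial σ k}
    (hw : w.IsHomogeneous d) (a : MvPolynomial σ k) (n : ℕ) :
    homogeneousComponent (n + d) (a * w) = homogeneousComponent n a * w := by
  let _ := gradedAlgebra (σ := σ) (R := k)
  have h := DirectSum.coe_decompose_mul_add_of_right_mem (homogeneousSubmodule σ k) (i := n)
    (a := a) hw
  have hc := decomposition.decompose'_apply (σ := σ) (R := k)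
  exact (hc _ _).symm.trans (h.trans (congrArg (· * w) (hc _ _)))

theorem homogeneousComponent_mul_of_isHomogeneous_of_lt {d : ℕ} {w : MvPolynomial σ k}
    (hw : w.IsHomogeneous d) (a : MvPolynomial σ k) {n : ℕ} (hn : n < d) :
    homogeneousComponent n (a * w) = 0 := by
  let _ := gradedAlgebra (σ := σ) (R := k)
  have h := DirectSum.coe_decompose_mul_of_right_mem_of_not_le (homogeneousSubmodule σ k) (n := n)
    (a := a) hw (by omega)
  exact (decomposition.decompose'_apply (a * w) n).symm.trans h

variable {d : ℕ} {W : Submodule k (MvPolynomial σ k)}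

theorem homogeneousComponent_eq_zero_of_mem_span (hW : W ≤ homogeneousSubmodule σ k d)
    {p : MvPolynomial σ k} (hp : p ∈ Ideal.span (W : Set (MvPolynomial σ k))) {n : ℕ}
    (hn : n < d) : homogeneousComponent n p = 0 := by
  obtain ⟨m, a, w, rfl⟩ := Submodule.mem_span_set'.1 hp
  rw [map_sum]
  exact Finset.sum_eq_zero fun i _ =>
    homogeneousComponent_mul_of_isHomogeneous_of_lt (hW (w i).2) _ hn

theorem homogeneousComponent_mem_mul_of_mem_span (hW : W ≤ homogeneousSubmodule σ k d)
    {p : MvPolynomial σ k} (hp : p ∈ Ideal.span (W : Set (MvPolynomial σ k))) (n : ℕ) :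
    homogeneousComponent (n + d) p ∈ W * homogeneousSubmodule σ k n := by
  obtain ⟨m, a, w, rfl⟩ := Submodule.mem_span_set'.1 hp
  rw [map_sum]
  refine Submodule.sum_mem _ fun i _ => ?_
  rw [smul_eq_mul, homogeneousComponent_mul_of_isHomogeneous (hW (w i).2),
    mul_comm (homogeneousComponent n (a i))]
  exact Submodule.mul_mem_mul (w i).2 (homogeneousComponent_mem _ _)

theorem homogeneousComponent_mem_span (hW : W ≤ homogeneousSubmodule σ k d)
    {p : MvPolynomial σ k} (hp : p ∈ Ideal.span (W : Set (MvPolynomial σ k))) (n : ℕ) :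
    homogeneousComponent n p ∈ Ideal.span (W : Set (MvPolynomial σ k)) := by
  rcases lt_or_ge n d with h | h
  · rw [homogeneousComponent_eq_zero_of_mem_span hW hp h]
    exact zero_mem _
  · obtain ⟨j, rfl⟩ := Nat.exists_eq_add_of_le' h
    have hle : W * homogeneousSubmodule σ k j ≤
        (Ideal.span (W : Set (MvPolynomial σ k))).restrictScalars k :=
      Submodule.mul_le.2 fun w hw q _ => Ideal.mul_mem_right _ _ (Ideal.subset_span hw)
    exact hle (homogeneousComponent_mem_mul_of_mem_span hW hp j)

theorem mem_mul_homogeneousSubmodule_of_mem_span (hW : W ≤ homogeneousSubmodule σ k d)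
    {p : MvPolynomial σ k} (hp : p ∈ Ideal.span (W : Set (MvPolynomial σ k))) {n : ℕ}
    (hpn : p.IsHomogeneous (n + d)) : p ∈ W * homogeneousSubmodule σ k n := by
  have := homogeneousComponent_mem_mul_of_mem_span hW hp n
  rwa [homogeneousComponent_eq_self hpn] at this

theorem eq_zero_of_mem_span_of_lt (hW : W ≤ homogeneousSubmodule σ k d)
    {p : MvPolynomial σ k} (hp : p ∈ Ideal.span (W : Set (MvPolynomial σ k))) {n : ℕ}
    (hpn : p.IsHomogeneous n) (hn : n < d) : p = 0 := by
  rw [← homogeneousComponent_eq_self hpn, homogeneousComponent_eq_zero_of_mem_span hW hp hn]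

end Graded

section Duality

variable {k : Type*} [Field k] {I : Ideal (MvPolynomial (Fin 3) k)}

theorem mem_colon_mIdeal {w : MvPolynomial (Fin 3) k} :
    w ∈ Submodule.colon I (mIdeal k : Set (MvPolynomial (Fin 3) k)) ↔ ∀ i, X i * w ∈ I := by
  rw [Submodule.mem_colon]
  constructor
  · intro h i
    rw [mul_comm]
    exact h _ (Ideal.subset_span ⟨i, rfl⟩)
  · intro h p hp
    have hle : mIdeal k ≤ Submodule.comap (LinearMap.mulLeft _ w) I := by
      refine Ideal.span_le.2 ?_
      rintro _ ⟨i, rfl⟩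
      simpa [mul_comm] using h i
    exact hle hp

/-- The socle functional of a graded Artinian algebra `R/I` with one-dimensional socle. -/
theorem exists_socle_functional (hI : ∀ p ∈ I, ∀ n, homogeneousComponent n p ∈ I)
    (hprim : ∃ N : ℕ, 1 ≤ N ∧ (mIdeal k) ^ N ≤ I) (hsoc : socDim I = 1) :
    ∃ (s : ℕ) (φ : MvPolynomial (Fin 3) k →ₗ[k] k),
      (∀ p, φ p = φ (homogeneousComponent s p)) ∧ ∀ f, f ∈ I ↔ ∀ p, φ (f * p) = 0 := by
  set J := Submodule.map (Ideal.Quotient.mkₐ k I).toLinearMap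
      ((Submodule.colon I (mIdeal k : Set (MvPolynomial (Fin 3) k))).restrictScalars k) with hJ
  have hfin : Module.finrank k J = 1 := hsoc
  have : Module.Free k J := Module.Free.of_divisionRing k J
  obtain ⟨⟨v, hv⟩, hv0, -⟩ := finrank_eq_one_iff'.1 hfin
  obtain ⟨w₀, hw₀, rfl⟩ := hv
  have hw₀I : w₀ ∉ I := by
    intro h
    apply hv0
    ext
    simpa using Ideal.Quotient.eq_zero_iff_mem.2 h
  obtain ⟨s, hs⟩ : ∃ s, homogeneousComponent s w₀ ∉ I := by
    by_contra! h
    apply hw₀I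
    rw [← sum_homogeneousComponent w₀]
    exact sum_mem fun i _ => h i
  set w := homogeneousComponent s w₀ with hw
  have hwJ : w ∈ Submodule.colon I (mIdeal k : Set (MvPolynomial (Fin 3) k)) := by
    rw [mem_colon_mIdeal]
    intro i
    have h1 := hI _ (mem_colon_mIdeal.1 hw₀ i) (s + 1)
    rwa [mul_comm, homogeneousComponent_mul_of_isHomogeneous (isHomogeneous_X k i), mul_comm] at h1
  have hgen : ∀ u ∈ Submodule.colon I (mIdeal k : Set (MvPolynomial (Fin 3) k)),
      ∃ c : k, c • w - u ∈ I := by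
    intro u hu
    have hne : (⟨Ideal.Quotient.mkₐ k I w, ⟨w, hwJ, rfl⟩⟩ : J) ≠ 0 := by
      intro h
      exact hs (Ideal.Quotient.eq_zero_iff_mem.1 (congrArg Subtype.val h))
    obtain ⟨c, hc⟩ := (finrank_eq_one_iff_of_nonzero' _ hne).1 hfin
      ⟨Ideal.Quotient.mkₐ k I u, ⟨u, hu, rfl⟩⟩
    refine ⟨c, ?_⟩
    have h2 : c • Ideal.Quotient.mkₐ k I w = Ideal.Quotient.mkₐ k I u := congrArg Subtype.val hc
    rw [← map_smul] at h2
    exact Ideal.Quotient.eq.1 h2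
  obtain ⟨l, hlw, hlI⟩ := Submodule.exists_le_ker_of_notMem (K := k) (p := I.restrictScalars k) hs
  have hww : homogeneousComponent s w = w :=
    homogeneousComponent_eq_self (homogeneousComponent_isHomogeneous s w₀)
  refine ⟨s, l ∘ₗ homogeneousComponent s, fun p => ?_, fun f => ⟨fun hf p => ?_, fun h => ?_⟩⟩
  · rw [LinearMap.comp_apply, LinearMap.comp_apply,
      homogeneousComponent_eq_self (homogeneousComponent_isHomogeneous s p)]
  · exact hlI (hI _ (I.mul_mem_right p hf) s)
  · by_contra hf
    obtain ⟨N, -, hN⟩ := hprim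
    have hex : ∃ j, ∀ q ∈ mIdeal k ^ j, f * q ∈ I := ⟨N, fun q hq => I.mul_mem_left _ (hN hq)⟩
    classical
    have hfind := Nat.find_spec hex
    have hmin := fun j => Nat.find_min hex (m := j)
    rcases hj : Nat.find hex with _ | j
    · rw [hj] at hfind
      exact hf (by simpa using hfind 1 (by simp))
    · have := hmin j (by omega)
      push Not at this
      obtain ⟨q, hq, hfq⟩ := this
      have hfqJ : f * q ∈ Submodule.colon I (mIdeal k : Set (MvPolynomial (Fin 3) k)) := by
        rw [mem_colon_mIdeal]
        intro i
        rw [mul_left_comm]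
        refine hfind _ ?_
        rw [hj, pow_succ']
        exact Ideal.mul_mem_mul (Ideal.subset_span ⟨i, rfl⟩) hq
      obtain ⟨c, hc⟩ := hgen _ hfqJ
      have h1 : l (homogeneousComponent s (c • w - f * q)) = 0 := hlI (hI _ hc s)
      have h2 : l (homogeneousComponent s (f * q)) = 0 := h q
      rw [map_sub, map_sub, h2, sub_zero, map_smul, map_smul, hww, smul_eq_mul] at h1
      have hc0 : c = 0 := (mul_eq_zero.1 h1).resolve_right hlw
      rw [hc0, zero_smul, zero_sub] at hc
      exact hfq (neg_mem_iff.1 hc)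

variable {s : ℕ} {φ : MvPolynomial (Fin 3) k →ₗ[k] k}

theorem mem_of_forall_isHomogeneous (hφ : ∀ p, φ p = φ (homogeneousComponent s p))
    (hI : ∀ f, f ∈ I ↔ ∀ p, φ (f * p) = 0) {t u : ℕ} (htu : t + u = s)
    {f : MvPolynomial (Fin 3) k} (hf : f.IsHomogeneous t)
    (h : ∀ p, p.IsHomogeneous u → φ (f * p) = 0) : f ∈ I := by
  refine (hI f).2 fun p => ?_
  rw [hφ, ← htu, add_comm t u, mul_comm f, homogeneousComponent_mul_of_isHomogeneous hf, mul_comm]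
  exact h _ (homogeneousComponent_isHomogeneous _ _)

theorem mem_of_isHomogeneous_of_lt (hφ : ∀ p, φ p = φ (homogeneousComponent s p))
    (hI : ∀ f, f ∈ I ↔ ∀ p, φ (f * p) = 0) {t : ℕ} (ht : s < t)
    {f : MvPolynomial (Fin 3) k} (hf : f.IsHomogeneous t) : f ∈ I := by
  refine (hI f).2 fun p => ?_
  rw [hφ, mul_comm f, homogeneousComponent_mul_of_isHomogeneous_of_lt hf _ ht, map_zero]

instance finiteDimensional_homogeneousSubmodule (n : ℕ) :
    FiniteDimensional k (homogeneousSubmodule (Fin 3) k n) :=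
  Module.Finite.iff_fg.2 (homogeneousSubmodule_fg _ _ n)

/-- A functional on forms of degree `t` which vanishes on `I` is given by a form of complementary
degree. -/
theorem exists_isHomogeneous_forall_eq (hφ : ∀ p, φ p = φ (homogeneousComponent s p))
    (hI : ∀ f, f ∈ I ↔ ∀ p, φ (f * p) = 0) {t u : ℕ} (htu : t + u = s)
    (χ : MvPolynomial (Fin 3) k →ₗ[k] k) (hχ : ∀ f ∈ I, f.IsHomogeneous t → χ f = 0) :
    ∃ g, g.IsHomogeneous u ∧ ∀ f, f.IsHomogeneous t → χ f = φ (g * f) := by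
  let L : homogeneousSubmodule (Fin 3) k u →ₗ[k] Module.Dual k (homogeneousSubmodule (Fin 3) k t) :=
    ((LinearMap.mul k (MvPolynomial (Fin 3) k)).compr₂ φ).domRestrict₁₂ _ _
  have hL : ∀ g f, L g f = φ (g.1 * f.1) := fun g f => rfl
  have hmem := FiniteDimensional.mem_span_of_iInf_ker_le_ker (𝕜 := k) (L := L)
    (K := χ.domRestrict (homogeneousSubmodule (Fin 3) k t)) (by
      intro f hf
      rw [LinearMap.mem_ker, LinearMap.domRestrict_apply]
      refine hχ _ (mem_of_forall_isHomogeneous hφ hI htu f.2 fun p hp => ?_) f.2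
      have := (Submodule.mem_iInf _).1 hf ⟨p, hp⟩
      rw [LinearMap.mem_ker, hL] at this
      rwa [mul_comm])
  have hmem : χ.domRestrict (homogeneousSubmodule (Fin 3) k t) ∈ LinearMap.range L := by
    rwa [← LinearMap.coe_range, Submodule.span_eq] at hmem
  obtain ⟨g, hg⟩ := hmem
  refine ⟨g, g.2, fun f hf => ?_⟩
  have := LinearMap.congr_fun hg ⟨f, hf⟩
  rw [hL] at this
  exact this.symm

end Duality


section Hilbert

variable {k : Type*} [Field k]

/-- The degree-`n` component of an ideal of `k[x,y,z]`. -/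
noncomputable abbrev idealPart (I : Ideal (MvPolynomial (Fin 3) k)) (n : ℕ) :
    Submodule k (MvPolynomial (Fin 3) k) :=
  I.restrictScalars k ⊓ homogeneousSubmodule (Fin 3) k n

/-- The forms `g` of degree `n` such that `z g ∈ I`. -/
noncomputable def zColon (I : Ideal (MvPolynomial (Fin 3) k)) (n : ℕ) :
    Submodule k (MvPolynomial (Fin 3) k) :=
  (idealPart I (n + 1)).comap (LinearMap.mulLeft k (X 2))

variable {I : Ideal (MvPolynomial (Fin 3) k)}

theorem mem_zColon {n : ℕ} {g : MvPolynomial (Fin 3) k} :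
    g ∈ zColon I n ↔ X 2 * g ∈ I ∧ g.IsHomogeneous n := by
  refine ⟨fun h => ⟨h.1, IsHomogeneous.of_X_mul h.2⟩, fun h => ⟨h.1, ?_⟩⟩
  have := (isHomogeneous_X k 2).mul h.2
  rwa [add_comm] at this

instance finiteDimensional_zColon (n : ℕ) : FiniteDimensional k (zColon I n) :=
  Submodule.finiteDimensional_of_le (S₂ := homogeneousSubmodule (Fin 3) k n)
    fun _ h => (mem_zColon.1 h).2

instance finiteDimensional_idealPart (n : ℕ) : FiniteDimensional k (idealPart I n) :=
  Submodule.finiteDimensional_of_le (S₂ := homogeneousSubmodule (Fin 3) k n) inf_le_right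

theorem finrank_degreeLT (k : Type*) [Field k] (n : ℕ) :
    Module.finrank k (Polynomial.degreeLT k n) = n := by
  rw [(Polynomial.degreeLTEquiv k n).finrank_eq, Module.finrank_fin_fun]

theorem finrank_idealPart_le (n : ℕ) : Module.finrank k (idealPart I (n + 1)) ≤
    Module.finrank k ((idealPart I (n + 1)).map (dehomog k).toLinearMap) +
      Module.finrank k (zColon I n) := by
  rw [← LinearMap.finrank_range_add_finrank_ker
    ((dehomog k).toLinearMap.domRestrict (idealPart I (n + 1))), LinearMap.range_domRestrict]
  gcongr
  rw [← Submodule.finrank_map_subtype_eq]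
  refine le_trans (Submodule.finrank_mono ?_)
    (Submodule.finrank_map_le (LinearMap.mulLeft k (X 2)) (zColon I n))
  rintro _ ⟨⟨f, hf⟩, hf0, rfl⟩
  obtain ⟨g, rfl⟩ := X2_dvd_of_dehomog_eq_zero hf.2 hf0
  exact ⟨g, hf, rfl⟩

theorem map_dehomog_idealPart_le (n : ℕ) :
    (idealPart I n).map (dehomog k).toLinearMap ≤ Polynomial.degreeLT k (n + 1) := by
  rintro _ ⟨f, hf, rfl⟩
  exact dehomog_mem_degreeLT hf.2

variable {s : ℕ} {φ : MvPolynomial (Fin 3) k →ₗ[k] k}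

theorem apply_mul_rehomog_dehomog (hI : ∀ f, f ∈ I ↔ ∀ p, φ (f * p) = 0)
    {g p : MvPolynomial (Fin 3) k} {n : ℕ} (hg : X 2 * g ∈ I) (hp : p.IsHomogeneous n) :
    φ (g * rehomog k n (dehomog k p)) = φ (g * p) := by
  obtain ⟨r, hr⟩ := X2_dvd_sub_rehomog_dehomog hp
  have h := (hI _).1 hg r
  rw [mul_comm (X 2) g, mul_assoc, ← hr, mul_sub, map_sub, sub_eq_zero] at h
  exact h.symm

theorem finrank_zColon_add_le (hφ : ∀ p, φ p = φ (homogeneousComponent s p))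
    (hI : ∀ f, f ∈ I ↔ ∀ p, φ (f * p) = 0) {n i : ℕ} (hs : n + i = s)
    (h0 : ∀ f ∈ I, f.IsHomogeneous n → f = 0) :
    Module.finrank k (zColon I n) +
      Module.finrank k ((idealPart I i).map (dehomog k).toLinearMap) ≤ i + 1 := by
  let B : zColon I n →ₗ[k] Module.Dual k (Polynomial.degreeLT k (i + 1)) :=
    ((LinearMap.mul k (MvPolynomial (Fin 3) k)).compr₂ φ).compl₁₂ (zColon I n).subtype
      (rehomog k i ∘ₗ (Polynomial.degreeLT k (i + 1)).subtype)
  have hB : ∀ g (p : MvPolynomial (Fin 3) k) (hp : p.IsHomogeneous i),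
      B g ⟨dehomog k p, dehomog_mem_degreeLT hp⟩ = φ (g * p) := fun g p hp =>
    apply_mul_rehomog_dehomog hI (mem_zColon.1 g.2).1 hp
  have hinj : Function.Injective B := by
    rw [← LinearMap.ker_eq_bot, LinearMap.ker_eq_bot']
    intro g hg
    refine Subtype.ext (h0 _ (mem_of_forall_isHomogeneous hφ hI hs (mem_zColon.1 g.2).2
      fun p hp => ?_) (mem_zColon.1 g.2).2)
    rw [← hB g p hp, hg, LinearMap.zero_apply]
  let W := ((idealPart I i).map (dehomog k).toLinearMap).comap
    (Polynomial.degreeLT k (i + 1)).subtype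
  have hle : LinearMap.range B ≤ W.dualAnnihilator := by
    rintro _ ⟨g, rfl⟩
    rw [Submodule.mem_dualAnnihilator]
    rintro ⟨_, _⟩ ⟨f, hf, rfl⟩
    refine (hB g f hf.2).trans ?_
    rw [mul_comm]
    exact (hI f).1 hf.1 g
  have h1 := Submodule.finrank_mono hle
  rw [LinearMap.finrank_range_of_inj hinj] at h1
  have h2 := Subspace.finrank_add_finrank_dualAnnihilator_eq W
  have h3 : Module.finrank k W = Module.finrank k ((idealPart I i).map (dehomog k).toLinearMap) :=
    (Submodule.comapSubtypeEquivOfLe (map_dehomog_idealPart_le i)).finrank_eq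
  rw [finrank_degreeLT] at h2
  omega

/-- If some form of degree `n` in `I` is nonzero modulo `z`, then the degree-`(n+j)` component of
`I` has dimension at least `j + 1` modulo `z`. -/
theorem add_one_le_finrank_map_dehomog {n : ℕ} {f : MvPolynomial (Fin 3) k}
    (hf : f ∈ idealPart I n) (hf0 : dehomog k f ≠ 0) (j : ℕ) :
    j + 1 ≤ Module.finrank k ((idealPart I (n + j)).map (dehomog k).toLinearMap) := by
  have hinj : Function.Injective (LinearMap.mulLeft k (dehomog k f)) :=
    fun p q h => mul_left_cancel₀ hf0 h
  rw [← finrank_degreeLT k (j + 1), (Submodule.equivMapOfInjective _ hinj _).finrank_eq]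
  refine Submodule.finrank_mono ?_
  rw [← map_dehomog_homogeneousSubmodule]
  rintro _ ⟨_, ⟨p, hp, rfl⟩, rfl⟩
  exact ⟨f * p, ⟨I.mul_mem_right _ hf.1, hf.2.mul hp⟩, map_mul (dehomog k) f p⟩

theorem map_dehomog_idealPart_add_eq {n : ℕ}
    (h : (idealPart I n).map (dehomog k).toLinearMap = Polynomial.degreeLT k (n + 1)) (j : ℕ) :
    (idealPart I (n + j)).map (dehomog k).toLinearMap = Polynomial.degreeLT k (n + j + 1) := by
  classical
  refine le_antisymm (map_dehomog_idealPart_le _) ?_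
  rw [Polynomial.degreeLT_eq_span_X_pow, Submodule.span_le]
  intro q hq
  simp only [Finset.coe_image, Finset.coe_range, Set.mem_image, Set.mem_Iio] at hq
  obtain ⟨a, ha, rfl⟩ := hq
  have hmem : (Polynomial.X ^ min a n : Polynomial k) ∈ Polynomial.degreeLT k (n + 1) := by
    rw [Polynomial.mem_degreeLT, Polynomial.degree_X_pow]
    exact_mod_cast (by omega : min a n < n + 1)
  rw [← h] at hmem
  obtain ⟨f, hf, hfX⟩ := hmem
  refine ⟨f * (X 0 ^ (a - min a n) * X 1 ^ (j - (a - min a n))),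
    ⟨I.mul_mem_right _ hf.1, hf.2.mul ?_⟩, ?_⟩
  · have := (isHomogeneous_X_pow (R := k) (0 : Fin 3) (a - min a n)).mul
      (isHomogeneous_X_pow (R := k) (1 : Fin 3) (j - (a - min a n)))
    rwa [show a - min a n + (j - (a - min a n)) = j by omega] at this
  · rw [AlgHom.toLinearMap_apply] at hfX ⊢
    rw [map_mul, hfX, map_mul, map_pow, map_pow, dehomog_X0, dehomog_X1, one_pow, mul_one,
      ← pow_add]
    congr 1
    omega

theorem exists_dehomog_ne_zero {n : ℕ}
    (hgen : I = Ideal.span (idealPart I n : Set (MvPolynomial (Fin 3) k)))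
    (hprim : ∃ N : ℕ, 1 ≤ N ∧ (mIdeal k) ^ N ≤ I) : ∃ f ∈ idealPart I n, dehomog k f ≠ 0 := by
  by_contra! h
  obtain ⟨N, -, hN⟩ := hprim
  have hle : I ≤ RingHom.ker (dehomog k) := by
    rw [hgen]
    exact Ideal.span_le.2 h
  have h1 : (X 1 ^ N : MvPolynomial (Fin 3) k) ∈ mIdeal k ^ N :=
    Ideal.pow_mem_pow (Ideal.subset_span (Set.mem_range_self 1)) N
  have := hle (hN h1)
  simp [RingHom.mem_ker] at this

/-- A Gorenstein ideal generated by `2n + 3` forms of degree `n + 1` has socle degree `2n`, and its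
generators surject onto the forms of degree `n + 1` modulo `z`. -/
theorem socle_degree_eq_and_exists_lift (hφ : ∀ p, φ p = φ (homogeneousComponent s p))
    (hI : ∀ f, f ∈ I ↔ ∀ p, φ (f * p) = 0) {n : ℕ}
    (hgen : I = Ideal.span (idealPart I (n + 1) : Set (MvPolynomial (Fin 3) k)))
    (hprim : ∃ N : ℕ, 1 ≤ N ∧ (mIdeal k) ^ N ≤ I)
    (hrank : Module.finrank k (idealPart I (n + 1)) = 2 * (n + 1) + 1) :
    s = 2 * n ∧ ∀ q : MvPolynomial (Fin 3) k, q.IsHomogeneous (n + 1) →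
      ∃ f ∈ idealPart I (n + 1), X 2 ∣ q - f := by
  have h0 : ∀ f ∈ I, f.IsHomogeneous n → f = 0 := fun f hf hfn => by
    rw [hgen] at hf
    exact eq_zero_of_mem_span_of_lt inf_le_right hf hfn n.lt_succ_self
  have hns : n ≤ s := by
    by_contra! hlt
    exact pow_ne_zero n (X_ne_zero (R := k) (0 : Fin 3))
      (h0 _ (mem_of_isHomogeneous_of_lt hφ hI hlt (isHomogeneous_X_pow _ n))
        (isHomogeneous_X_pow _ n))
  obtain ⟨i, rfl⟩ := Nat.exists_eq_add_of_le hns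
  have h1 := finrank_idealPart_le (I := I) n
  rw [hrank] at h1
  have h2 := finrank_zColon_add_le hφ hI rfl h0
  have h3 : Module.finrank k ((idealPart I (n + 1)).map (dehomog k).toLinearMap) ≤ n + 2 := by
    simpa [finrank_degreeLT] using Submodule.finrank_mono (map_dehomog_idealPart_le (I := I) (n + 1))
  have hfull : n + 2 ≤ Module.finrank k ((idealPart I (n + 1)).map (dehomog k).toLinearMap) →
      (idealPart I (n + 1)).map (dehomog k).toLinearMap = Polynomial.degreeLT k (n + 1 + 1) :=
    fun h => Submodule.eq_of_le_of_finrank_le (map_dehomog_idealPart_le _)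
      (by rwa [finrank_degreeLT])
  have hi : i ≤ n := by
    by_contra! hlt
    obtain ⟨j, rfl⟩ := Nat.exists_eq_add_of_le (show n + 1 ≤ i from hlt)
    obtain ⟨f, hf, hf0⟩ := exists_dehomog_ne_zero hgen hprim
    have h4 := add_one_le_finrank_map_dehomog hf hf0 j
    have h5 := map_dehomog_idealPart_add_eq (hfull (by omega)) j
    rw [h5, finrank_degreeLT] at h2
    omega
  refine ⟨by omega, fun q hq => ?_⟩
  have hmem := dehomog_mem_degreeLT hq
  rw [← hfull (by omega)] at hmem
  obtain ⟨f, hf, hfq⟩ := hmem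
  refine ⟨f, hf, X2_dvd_of_dehomog_eq_zero (IsHomogeneous.sub hq hf.2) ?_⟩
  rw [map_sub, sub_eq_zero]
  exact hfq.symm

end Hilbert

section Powers

variable {k : Type*} [Field k] {I : Ideal (MvPolynomial (Fin 3) k)}
  {φ : MvPolynomial (Fin 3) k →ₗ[k] k} {e : ℕ}

/-- A functional `ψ` on forms of degree `2(e+2)` vanishing on the squares of the generators induces
a linear map from the generators to forms of degree `e`. -/
theorem exists_linearMap_of_functional
    (hφ : ∀ p, φ p = φ (homogeneousComponent (2 * (e + 1)) p))
    (hI : ∀ f, f ∈ I ↔ ∀ p, φ (f * p) = 0) (h0 : ∀ f ∈ I, ∀ n < e + 2, f.IsHomogeneous n → f = 0)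
    (ψ : MvPolynomial (Fin 3) k →ₗ[k] k)
    (hψ : ∀ f ∈ idealPart I (e + 2), ∀ g ∈ idealPart I (e + 2), ψ (f * g) = 0) :
    ∃ D : MvPolynomial (Fin 3) k →ₗ[k] MvPolynomial (Fin 3) k,
      ∀ f ∈ idealPart I (e + 2), (D f).IsHomogeneous e ∧
        ∀ h, h.IsHomogeneous (e + 2) → ψ (f * h) = φ (D f * h) := by
  have hex : ∀ f : idealPart I (e + 2), ∃ g : MvPolynomial (Fin 3) k, g.IsHomogeneous e ∧
      ∀ h, h.IsHomogeneous (e + 2) → ψ (f * h) = φ (g * h) := fun f =>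
    exists_isHomogeneous_forall_eq hφ hI (t := e + 2) (u := e) (by ring)
      (ψ ∘ₗ LinearMap.mulLeft k f.1) fun h hh hhom => hψ _ f.2 _ ⟨hh, hhom⟩
  choose G hG hGψ using hex
  have huniq : ∀ g g' : MvPolynomial (Fin 3) k, g.IsHomogeneous e → g'.IsHomogeneous e →
      (∀ h, h.IsHomogeneous (e + 2) → φ (g * h) = φ (g' * h)) → g = g' := by
    intro g g' hg hg' h
    refine sub_eq_zero.1 (h0 _ (mem_of_forall_isHomogeneous hφ hI (t := e) (u := e + 2) (by ring)
      (hg.sub hg') fun p hp => ?_) e (by omega) (hg.sub hg'))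
    rw [sub_mul, map_sub, h p hp, sub_self]
  have hadd : ∀ a b, G (a + b) = G a + G b := fun a b => by
    refine huniq _ _ (hG _) ((hG a).add (hG b)) fun h hh => ?_
    rw [← hGψ _ h hh, Submodule.coe_add, add_mul, add_mul, map_add, map_add, hGψ a h hh, hGψ b h hh]
  have hsmul : ∀ (c : k) a, G (c • a) = c • G a := fun c a => by
    have hc : (c • G a).IsHomogeneous e := (homogeneousSubmodule (Fin 3) k e).smul_mem c (hG a)
    refine huniq _ _ (hG _) hc fun h hh => ?_
    rw [← hGψ _ h hh, Submodule.coe_smul, smul_mul_assoc, smul_mul_assoc, map_smul, map_smul,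
      hGψ a h hh]
  obtain ⟨D, hD⟩ := LinearMap.exists_extend
    (⟨⟨G, hadd⟩, hsmul⟩ : idealPart I (e + 2) →ₗ[k] MvPolynomial (Fin 3) k)
  have hDG : ∀ f : idealPart I (e + 2), D f = G f := LinearMap.congr_fun hD
  refine ⟨D, fun f hf => ?_⟩
  rw [show D f = G ⟨f, hf⟩ from hDG ⟨f, hf⟩]
  exact ⟨hG ⟨f, hf⟩, hGψ ⟨f, hf⟩⟩

theorem homogeneousSubmodule_le_idealPart_mul_idealPart
    (hφ : ∀ p, φ p = φ (homogeneousComponent (2 * (e + 1)) p))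
    (hI : ∀ f, f ∈ I ↔ ∀ p, φ (f * p) = 0)
    (hgen : I = Ideal.span (idealPart I (e + 2) : Set (MvPolynomial (Fin 3) k)))
    (hlift : ∀ q : MvPolynomial (Fin 3) k, q.IsHomogeneous (e + 2) →
      ∃ f ∈ idealPart I (e + 2), X 2 ∣ q - f) :
    homogeneousSubmodule (Fin 3) k (e + 2 + (e + 2)) ≤
      idealPart I (e + 2) * idealPart I (e + 2) := by
  have h0 : ∀ f ∈ I, ∀ n < e + 2, f.IsHomogeneous n → f = 0 := fun f hf n hn hfn => by
    rw [hgen] at hf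
    exact eq_zero_of_mem_span_of_lt inf_le_right hf hfn hn
  intro p hp
  by_contra hpV
  obtain ⟨ψ, hψp, hψ⟩ := Submodule.exists_le_ker_of_notMem hpV
  obtain ⟨D, hD⟩ := exists_linearMap_of_functional hφ hI h0 ψ fun f hf g hg =>
    hψ (Submodule.mul_mem_mul hf hg)
  have hD0 : ∀ f ∈ idealPart I (e + 2), D f = 0 := by
    intro f hf
    have hX : ∀ (i : Fin 3) {n : ℕ} {p : MvPolynomial (Fin 3) k}, p.IsHomogeneous n →
        (X i * p).IsHomogeneous (n + 1) := fun i n p hp => by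
      rw [add_comm]
      exact (isHomogeneous_X k i).mul hp
    refine apply_eq_zero_of_linear_syzygies (V := idealPart I (e + 2)) (φ := φ) (m := e)
      (fun f => ⟨fun h => ⟨h.2, fun p _ => (hI f).1 h.1 p⟩, fun h =>
        ⟨mem_of_forall_isHomogeneous hφ hI (by ring) h.1 h.2, h.1⟩⟩)
      (fun χ => exists_isHomogeneous_forall_eq hφ hI (by ring) χ fun f hf hfe => ?_)
      (fun g hg h => h0 g (mem_of_forall_isHomogeneous hφ hI (by ring) hg h) _ (by omega) hg)
      hlift (by omega) (fun f hf => (hD f hf).1) (fun a ha b hb c hc habc => ?_) hf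
    · rw [h0 f hf _ (by omega) hfe, map_zero]
    · have hE := ((hX 0 (hD a ha).1).add (hX 1 (hD b hb).1)).add (hX 2 (hD c hc).1)
      refine h0 _ (mem_of_forall_isHomogeneous (u := e + 1) hφ hI (by ring) hE fun p hp => ?_) _
        (by omega) hE
      have h1 := (hD a ha).2 _ (hX 0 hp)
      have h2 := (hD b hb).2 _ (hX 1 hp)
      have h3 := (hD c hc).2 _ (hX 2 hp)
      rw [show (X 0 * D a + X 1 * D b + X 2 * D c) * p =
        D a * (X 0 * p) + D b * (X 1 * p) + D c * (X 2 * p) by ring, map_add, map_add, ← h1, ← h2,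
        ← h3, ← map_add, ← map_add, show a * (X 0 * p) + b * (X 1 * p) + c * (X 2 * p) =
        (X 0 * a + X 1 * b + X 2 * c) * p by ring, habc, zero_mul, map_zero]
  have hpI : p ∈ Ideal.span (idealPart I (e + 2) : Set (MvPolynomial (Fin 3) k)) := by
    rw [← hgen]
    exact mem_of_isHomogeneous_of_lt hφ hI (by omega) hp
  have hle : idealPart I (e + 2) * homogeneousSubmodule (Fin 3) k (e + 2) ≤ LinearMap.ker ψ :=
    Submodule.mul_le.2 fun f hf h hh => by
      rw [LinearMap.mem_ker, (hD f hf).2 h hh, hD0 f hf, zero_mul, map_zero]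
  exact hψp (hle (mem_mul_homogeneousSubmodule_of_mem_span inf_le_right hpI hp))

theorem homogeneousSubmodule_le_mIdeal_pow (k : Type*) [Field k] (n : ℕ) :
    homogeneousSubmodule (Fin 3) k n ≤ (mIdeal k ^ n).restrictScalars k := by
  have hX : ∀ (i : Fin 3) a, (X i ^ a : MvPolynomial (Fin 3) k) ∈ mIdeal k ^ a := fun i a =>
    Ideal.pow_mem_pow (Ideal.subset_span (Set.mem_range_self i)) a
  refine homogeneousSubmodule_le_of_monomial_mem fun s hs => ?_
  rw [monomial_fin_three, ← hs, degree_fin_three, pow_add, pow_add]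
  exact Ideal.mul_mem_mul (Ideal.mul_mem_mul (hX _ _) (hX _ _)) (hX _ _)

theorem mIdeal_pow_le {n : ℕ} {J : Ideal (MvPolynomial (Fin 3) k)}
    (h : homogeneousSubmodule (Fin 3) k n ≤ J.restrictScalars k) : mIdeal k ^ n ≤ J := by
  change idealOfVars (Fin 3) k ^ n ≤ J
  rw [pow_idealOfVars_eq_span, Ideal.span_le]
  rintro _ ⟨s, hs, rfl⟩
  exact h (isHomogeneous_monomial _ hs)

theorem pow_eq_mIdeal_pow {d : ℕ}
    (hgen : I = Ideal.span (idealPart I d : Set (MvPolynomial (Fin 3) k)))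
    (hsq : homogeneousSubmodule (Fin 3) k (d + d) ≤ idealPart I d * idealPart I d)
    (hbig : ∀ n, 2 * d ≤ n → ∀ p : MvPolynomial (Fin 3) k, p.IsHomogeneous n → p ∈ I)
    (N : ℕ) (hN : 2 ≤ N) : I ^ N = mIdeal k ^ (d * N) := by
  have hle : I ≤ mIdeal k ^ d := by
    rw [hgen]
    exact Ideal.span_le.2 fun f hf => homogeneousSubmodule_le_mIdeal_pow k d hf.2
  refine le_antisymm ?_ ?_
  · rw [pow_mul]
    exact Ideal.pow_right_mono hle N
  · induction N, hN using Nat.le_induction with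
    | base =>
      rw [mul_two]
      refine mIdeal_pow_le (hsq.trans (Submodule.mul_le.2 fun f hf g hg => ?_))
      rw [pow_two]
      exact Ideal.mul_mem_mul hf.1 hg.1
    | succ N hN ih =>
      refine mIdeal_pow_le fun p hp => ?_
      have hd : 2 * d ≤ d * (N + 1) := by nlinarith
      have hpI := hbig _ hd p hp
      rw [hgen] at hpI
      refine (Submodule.mul_le.2 fun f hf g hg => ?_ : idealPart I d *
        homogeneousSubmodule (Fin 3) k (d * N) ≤ (I ^ (N + 1)).restrictScalars k)
        (mem_mul_homogeneousSubmodule_of_mem_span inf_le_right hpI hp)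
      rw [pow_succ']
      exact Ideal.mul_mem_mul hf.1 (ih (homogeneousSubmodule_le_mIdeal_pow k _ hg))

end Powers

end MvPolynomial

/-- If `char k ≠ 2`, `d ≥ 2` and `I ⊆ k[x,y,z]` is a proper homogeneous `𝔪`-primary
Gorenstein ideal (1-dimensional socle) generated by its degree-`d` component with
`dim_k I_d = 2d+1` (datum `(d, 2d+1)`), then `I^N = 𝔪^{dN}` for every `N ≥ 2`. -/
theorem stmt10 {k : Type*} [Field k] (hchar : ringChar k ≠ 2) (d : ℕ) (hd : 2 ≤ d)
    (I : Ideal (MvPolynomial (Fin 3) k))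
    (hproper : I ≠ ⊤)
    (hprim : ∃ N : ℕ, 1 ≤ N ∧ (mIdeal k) ^ N ≤ I)
    (hgen : I = Ideal.span
      ((I.restrictScalars k ⊓ homogeneousSubmodule (Fin 3) k d : Submodule k _) : Set _))
    (hrank : Module.finrank k ↥(I.restrictScalars k ⊓ homogeneousSubmodule (Fin 3) k d)
      = 2 * d + 1)
    (hsoc : socDim I = 1) :
    ∀ N : ℕ, 2 ≤ N → I ^ N = (mIdeal k) ^ (d * N) := by
  obtain ⟨e, rfl⟩ := Nat.exists_eq_add_of_le' hd
  have hhom : ∀ p ∈ I, ∀ n, homogeneousComponent n p ∈ I := fun p hp n => by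
    rw [hgen] at hp ⊢
    exact homogeneousComponent_mem_span inf_le_right hp n
  obtain ⟨s, φ, hφ, hI⟩ := exists_socle_functional hhom hprim hsoc
  obtain ⟨rfl, hlift⟩ := socle_degree_eq_and_exists_lift hφ hI hgen hprim hrank
  exact pow_eq_mIdeal_pow hgen
    (homogeneousSubmodule_le_idealPart_mul_idealPart hφ hI hgen hlift)
    fun n hn p hp => mem_of_isHomogeneous_of_lt hφ hI (by omega) hp
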